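/- Let S be a finite type and X ⊆ S^ℤ a subshift equipped with a group structure (multiplication · : X × X → X and inversion ⁻¹ : X → X) such that multiplication and inversion are block maps (continuous and shift-equivariant: σ(x·y) = σ(x)·σ(y) and σ(x⁻¹) = σ(x)⁻¹). Then there exist a finite group G', a subshift Y ⊆ G'^ℤ closed under the cellwise multiplication and inversion of G', and a bijection φ : X → Y that is a homeomorphism, satisfies φ ∘ σ = σ ∘ φ, and is a group isomorphism. -/

import Mathlib

/-- The shift map on the full shift `ℤ → α`. -/
def shiftMap {α : Type*} (x : ℤ → α) : ℤ → α := fun i => x (i + 1)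

/-- `X` is a subshift: shift-invariant (`σ(X) = X`) and closed. -/
def IsSubshift {α : Type*} (X : Set (ℤ → α)) : Prop :=
  (∀ x ∈ X, shiftMap x ∈ X) ∧ (∀ x ∈ X, ∃ y ∈ X, shiftMap y = x) ∧
    ∀ x : ℤ → α, (∀ n : ℕ, ∃ y ∈ X, ∀ i : ℤ, |i| ≤ (n : ℤ) → y i = x i) → x ∈ X

/-- A map `F` out of a subshift `X` has radius at most `r`. -/
def HasRadius1 {α β : Type*} (X : Set (ℤ → α)) (F : (ℤ → α) → ℤ → β) (r : ℕ) : Prop :=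
  ∀ x ∈ X, ∀ y ∈ X, ∀ i : ℤ, (∀ j : ℤ, |j - i| ≤ (r : ℤ) → x j = y j) → F x i = F y i

/-- A binary operation on subshifts has radius at most `r`. -/
def HasRadius2 {α β γ : Type*} (X : Set (ℤ → α)) (Y : Set (ℤ → β))
    (F : (ℤ → α) → (ℤ → β) → ℤ → γ) (r : ℕ) : Prop :=
  ∀ x ∈ X, ∀ x' ∈ X, ∀ y ∈ Y, ∀ y' ∈ Y, ∀ i : ℤ,
    (∀ j : ℤ, |j - i| ≤ (r : ℤ) → x j = x' j ∧ y j = y' j) → F x y i = F x' y' i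

/-- Conjugacy data of a group subshift `(X, mul, inv)` to a subshift `Y` over a finite
group `G'` which is closed under the cellwise group operations: a shift-commuting
bijection `φ : X → Y` which is a group isomorphism, with block-map inverse `ψ`. -/
def GroupConjugacyData {S : Type*} (X : Set (ℤ → S))
    (mul : (ℤ → S) → (ℤ → S) → (ℤ → S)) (inv : (ℤ → S) → (ℤ → S))
    {G' : Type} [Group G'] (Y : Set (ℤ → G')) : Prop :=
  IsSubshift Y ∧
  (∀ y ∈ Y, ∀ z ∈ Y, (fun i => y i * z i) ∈ Y) ∧
  (∀ y ∈ Y, (fun i => (y i)⁻¹) ∈ Y) ∧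
  ∃ (φ : (ℤ → S) → (ℤ → G')) (ψ : (ℤ → G') → (ℤ → S)),
    Set.BijOn φ X Y ∧ (∀ x ∈ X, ψ (φ x) = x) ∧
    (∃ r : ℕ, HasRadius1 X φ r) ∧ (∃ r : ℕ, HasRadius1 Y ψ r) ∧
    (∀ x ∈ X, φ (shiftMap x) = shiftMap (φ x)) ∧
    (∀ x ∈ X, ∀ y ∈ X, φ (mul x y) = fun i => φ x i * φ y i) ∧
    (∀ x ∈ X, φ (inv x) = fun i => (φ x i)⁻¹)

/-- Translation of a bi-infinite configuration by `i`. -/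
def configTranslate {α : Type*} (i : ℤ) (x : ℤ → α) : ℤ → α := fun j => x (j + i)

theorem shiftMap_injective {α : Type*} : Function.Injective (shiftMap (α := α)) := by
  intro x y h
  funext i
  simpa [shiftMap] using congrFun h (i - 1)

theorem configTranslate_zero {α : Type*} (x : ℤ → α) : configTranslate 0 x = x := by
  funext j
  simp [configTranslate]

theorem shiftMap_configTranslate {α : Type*} (i : ℤ) (x : ℤ → α) :
    shiftMap (configTranslate i x) = configTranslate (i + 1) x := by
  funext j
  simp only [shiftMap, configTranslate]
  congr 1
  ring

theorem IsSubshift.configTranslate_mem {α : Type*} {X : Set (ℤ → α)} (hX : IsSubshift X) (i : ℤ)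
    {x : ℤ → α} (hx : x ∈ X) : configTranslate i x ∈ X := by
  induction i with
  | zero => rwa [configTranslate_zero]
  | succ n ih =>
    rw [← shiftMap_configTranslate]
    exact hX.1 _ ih
  | pred n ih =>
    obtain ⟨y, hy, h⟩ := hX.2.1 _ ih
    have : y = configTranslate (-(n : ℤ) - 1) x :=
      shiftMap_injective (by rw [h, shiftMap_configTranslate, sub_add_cancel])
    exact this ▸ hy

theorem configTranslate_map₂ {α : Type*} {X : Set (ℤ → α)} (hX : IsSubshift X)
    {mul : (ℤ → α) → (ℤ → α) → (ℤ → α)}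
    (hmul : ∀ x ∈ X, ∀ y ∈ X, shiftMap (mul x y) = mul (shiftMap x) (shiftMap y)) (i : ℤ)
    {x y : ℤ → α} (hx : x ∈ X) (hy : y ∈ X) :
    configTranslate i (mul x y) = mul (configTranslate i x) (configTranslate i y) := by
  induction i with
  | zero => simp only [configTranslate_zero]
  | succ n ih =>
    rw [← shiftMap_configTranslate, ih,
      hmul _ (hX.configTranslate_mem _ hx) _ (hX.configTranslate_mem _ hy),
      shiftMap_configTranslate, shiftMap_configTranslate]
  | pred n ih =>
    apply shiftMap_injective
    rw [hmul _ (hX.configTranslate_mem _ hx) _ (hX.configTranslate_mem _ hy)]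
    simpa only [shiftMap_configTranslate, sub_add_cancel] using ih

/-- The coarsest congruence on a monoid that refines the fibres of `f`. -/
def syntacticCon {M β : Type*} [Monoid M] (f : M → β) : Con M where
  r x y := ∀ a b, f (a * x * b) = f (a * y * b)
  iseqv := ⟨fun _ _ _ => rfl, fun h a b => (h a b).symm,
    fun h h' a b => (h a b).trans (h' a b)⟩
  mul' := by
    intro w x y z h h' a b
    have h₁ := h a (y * b)
    have h₂ := h' (a * x) b
    simp only [mul_assoc] at h₁ h₂ ⊢
    exact h₁.trans h₂

/-- A group subshift has a finite quotient group, given by a local rule, which determines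
the symbol at the origin. -/
theorem exists_finite_local_quotient {S : Type*} [Fintype S] (X : Set (ℤ → S))
    (mul : (ℤ → S) → (ℤ → S) → (ℤ → S)) (inv : (ℤ → S) → (ℤ → S)) (e : ℤ → S)
    (he : e ∈ X)
    (hmul_mem : ∀ x ∈ X, ∀ y ∈ X, mul x y ∈ X)
    (hinv_mem : ∀ x ∈ X, inv x ∈ X)
    (hassoc : ∀ x ∈ X, ∀ y ∈ X, ∀ z ∈ X, mul (mul x y) z = mul x (mul y z))
    (hunit : ∀ x ∈ X, mul e x = x ∧ mul x e = x)
    (hinverse : ∀ x ∈ X, mul (inv x) x = e ∧ mul x (inv x) = e)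
    (hmul_rad : ∃ r : ℕ, HasRadius2 X X mul r) :
    ∃ (G : Type) (_ : Fintype G) (_ : Group G) (π : (ℤ → S) → G) (s : G → S) (R : ℕ),
      (∀ x ∈ X, ∀ y ∈ X, π (mul x y) = π x * π y) ∧
      (∀ x ∈ X, ∀ y ∈ X, (∀ j : ℤ, |j| ≤ (R : ℤ) → x j = y j) → π x = π y) ∧
      (∀ x ∈ X, s (π x) = x 0) := by
  classical
  obtain ⟨r, hr⟩ := hmul_rad
  let : Mul X := ⟨fun x y => ⟨mul x y, hmul_mem _ x.2 _ y.2⟩⟩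
  let : One X := ⟨⟨e, he⟩⟩
  let : Inv X := ⟨fun x => ⟨inv x, hinv_mem _ x.2⟩⟩
  let : Group X := Group.ofLeftAxioms
    (fun x y z => Subtype.ext (hassoc _ x.2 _ y.2 _ z.2))
    (fun x => Subtype.ext (hunit _ x.2).1)
    (fun x => Subtype.ext (hinverse _ x.2).1)
  let c : Con X := syntacticCon fun x => x.1 0
  have c_of_agree (x y : X) (h : ∀ j : ℤ, |j| ≤ ((2 * r : ℕ) : ℤ) → x.1 j = y.1 j) :
      c x y := by
    intro a b
    refine hr _ (a * x).2 _ (a * y).2 _ b.2 _ b.2 0 fun j hj => ⟨?_, rfl⟩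
    refine hr _ a.2 _ a.2 _ x.2 _ y.2 j fun k hk => ⟨rfl, h k ?_⟩
    rw [abs_le] at *
    push_cast
    constructor <;> linarith
  have c_origin (x y : X) (h : c x y) : x.1 0 = y.1 0 := by
    simpa using h 1 1
  have : Finite c.Quotient := by
    refine Finite.of_injective
      (fun q (j : Set.Icc (-((2 * r : ℕ) : ℤ)) ((2 * r : ℕ) : ℤ)) => (Quotient.out q).1 j) ?_
    intro p q h
    rw [← Quotient.out_eq p, ← Quotient.out_eq q]
    exact Quotient.sound (c_of_agree _ _ fun j hj => congrFun h ⟨j, abs_le.mp hj⟩)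
  let E : Shrink.{0} c.Quotient ≃* c.Quotient := Shrink.mulEquiv
  have : Finite (Shrink.{0} c.Quotient) := Finite.of_equiv _ E.symm.toEquiv
  let π (x : ℤ → S) : Shrink.{0} c.Quotient :=
    if hx : x ∈ X then E.symm ((⟨x, hx⟩ : X) : c.Quotient) else 1
  have hπ (x : ℤ → S) (hx : x ∈ X) : π x = E.symm ((⟨x, hx⟩ : X) : c.Quotient) := dif_pos hx
  refine ⟨Shrink.{0} c.Quotient, Fintype.ofFinite _, inferInstance, π,
    fun g => Con.liftOn (E g) (fun x => x.1 0) c_origin, 2 * r, ?_, ?_, ?_⟩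
  · intro x hx y hy
    rw [hπ x hx, hπ y hy, hπ _ (hmul_mem x hx y hy), ← map_mul]
    rfl
  · intro x hx y hy h
    rw [hπ x hx, hπ y hy]
    exact congrArg _ ((Con.eq c).mpr (c_of_agree ⟨x, hx⟩ ⟨y, hy⟩ h))
  · intro x hx
    simp only [hπ x hx, MulEquiv.apply_symm_apply]
    rfl

/-- Theorem (Kitchens-style recoding): every group subshift (a subshift equipped with
a group structure whose multiplication and inversion are block maps) is algebraically
conjugate to a subshift over a finite group closed under the cellwise operations. -/
theorem stmt11 {S : Type*} [Fintype S]
    (X : Set (ℤ → S)) (hX : IsSubshift X)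
    (mul : (ℤ → S) → (ℤ → S) → (ℤ → S)) (inv : (ℤ → S) → (ℤ → S)) (e : ℤ → S)
    (he : e ∈ X)
    (hmul_mem : ∀ x ∈ X, ∀ y ∈ X, mul x y ∈ X)
    (hinv_mem : ∀ x ∈ X, inv x ∈ X)
    (hassoc : ∀ x ∈ X, ∀ y ∈ X, ∀ z ∈ X, mul (mul x y) z = mul x (mul y z))
    (hunit : ∀ x ∈ X, mul e x = x ∧ mul x e = x)
    (hinverse : ∀ x ∈ X, mul (inv x) x = e ∧ mul x (inv x) = e)
    (hmul_rad : ∃ r : ℕ, HasRadius2 X X mul r)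
    (hinv_rad : ∃ r : ℕ, HasRadius1 X inv r)
    (hmul_shift : ∀ x ∈ X, ∀ y ∈ X, shiftMap (mul x y) = mul (shiftMap x) (shiftMap y))
    (hinv_shift : ∀ x ∈ X, shiftMap (inv x) = inv (shiftMap x)) :
    ∃ (G' : Type) (_ : Fintype G') (iG : Group G') (Y : Set (ℤ → G')),
      @GroupConjugacyData S X mul inv G' iG Y := by
  obtain ⟨G, iF, iG, π, s, R, hπ_mul, hπ_local, hs⟩ :=
    exists_finite_local_quotient X mul inv e he hmul_mem hinv_mem hassoc hunit hinverse hmul_rad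
  let φ (x : ℤ → S) (i : ℤ) : G := π (configTranslate i x)
  let ψ (y : ℤ → G) (i : ℤ) : S := s (y i)
  have hψφ (x) (hx : x ∈ X) (i : ℤ) : s (φ x i) = x i := by
    simp [φ, hs _ (hX.configTranslate_mem i hx), configTranslate]
  have hφ_shift (x : ℤ → S) : φ (shiftMap x) = shiftMap (φ x) := by
    funext i
    change π _ = π _
    congr 1
    funext j
    simp only [shiftMap, configTranslate, add_assoc]
  have hφ_mul (x) (hx : x ∈ X) (y) (hy : y ∈ X) : φ (mul x y) = fun i => φ x i * φ y i := by
    funext i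
    simp only [φ]
    rw [configTranslate_map₂ hX hmul_shift i hx hy,
      hπ_mul _ (hX.configTranslate_mem i hx) _ (hX.configTranslate_mem i hy)]
  have hφ_one (i : ℤ) : φ e i = 1 := by
    have h := congrFun (hφ_mul e he e he) i
    rw [(hunit e he).1] at h
    exact left_eq_mul.mp h
  have hφ_inv (x) (hx : x ∈ X) : φ (inv x) = fun i => (φ x i)⁻¹ := by
    funext i
    have h := congrFun (hφ_mul _ (hinv_mem x hx) x hx) i
    rw [(hinverse x hx).1, hφ_one] at h
    exact eq_inv_of_mul_eq_one_left h.symm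
  have hφ_rad : HasRadius1 X φ R := by
    intro x hx y hy i h
    refine hπ_local _ (hX.configTranslate_mem i hx) _ (hX.configTranslate_mem i hy) fun j hj => h _ ?_
    rwa [add_sub_cancel_right]
  refine ⟨G, iF, iG, φ '' X, ⟨?_, ?_, ?_⟩, ?_, ?_, φ, ψ,
    ⟨Set.mapsTo_image _ _, ?_, Set.surjOn_image _ _⟩,
    fun x hx => funext (hψφ x hx), ⟨R, hφ_rad⟩, ⟨0, ?_⟩, fun x _ => hφ_shift x, hφ_mul, hφ_inv⟩
  · rintro _ ⟨x, hx, rfl⟩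
    exact ⟨shiftMap x, hX.1 x hx, hφ_shift x⟩
  · rintro _ ⟨x, hx, rfl⟩
    obtain ⟨y, hy, rfl⟩ := hX.2.1 x hx
    exact ⟨φ y, ⟨y, hy, rfl⟩, (hφ_shift y).symm⟩
  · intro y h
    have approx (n : ℕ) : ∃ x ∈ X, ∀ i : ℤ, |i| ≤ (n : ℤ) → x i = ψ y i ∧ φ x i = y i := by
      obtain ⟨_, ⟨x, hx, rfl⟩, hxy⟩ := h n
      exact ⟨x, hx, fun i hi => ⟨by simp only [ψ, ← hxy i hi, hψφ x hx], hxy i hi⟩⟩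
    have hy : ψ y ∈ X := hX.2.2 _ fun n => by
      obtain ⟨x, hx, hxy⟩ := approx n
      exact ⟨x, hx, fun i hi => (hxy i hi).1⟩
    refine ⟨ψ y, hy, funext fun i => ?_⟩
    obtain ⟨x, hx, hxy⟩ := approx (i.natAbs + R)
    rw [← (hxy i (by push_cast; simp)).2]
    refine hφ_rad _ hy _ hx i fun j hj => ((hxy j ?_).1).symm
    push_cast
    linarith [abs_sub_abs_le_abs_sub j i]
  · rintro _ ⟨x, hx, rfl⟩ _ ⟨y, hy, rfl⟩
    exact ⟨mul x y, hmul_mem x hx y hy, hφ_mul x hx y hy⟩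
  · rintro _ ⟨x, hx, rfl⟩
    exact ⟨inv x, hinv_mem x hx, hφ_inv x hx⟩
  · intro x hx y hy h
    funext i
    rw [← hψφ x hx, ← hψφ y hy, h]
  · intro y _ z _ i h
    exact congrArg s (h i (by simp))
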